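/- arXiv:1106.0877 — 2 statements merged into one kernel-verified Lean document; each statement's English description precedes it below -/
import Mathlib

section
/- Let (X,d) be a complete separable metric space in which closed balls are compact, let p ≥ 2 and q = p/(p−1), and let μ be a probability measure on X. If μ satisfies the (τ)-log-Sobolev inequality (τ)-LSI_p(1,A) for some A > 0 (i.e., the (τ)-log-Sobolev inequality for the cost α_p(x) = |x|^p), then μ satisfies the transport-entropy inequality T_p(C) (i.e., T_{α_p}(C)) with C = ( a_p · max(1,A) )^{p−1}, where a_p = inf_{t∈(0,1)} { t^{−(q−1)} · ( 1 + (p^q/(p−1)) · ∫₀^t ε(u)/u du ) } and ε(u) = (1 − u^{1/(p−1)})^{−(p−1)} − 1. -/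
open MeasureTheory Filter Set Topology
open scoped ENNReal NNReal

noncomputable section

/-- The right derivative of a function `α : ℝ → ℝ`. -/
def rightD (α : ℝ → ℝ) (x : ℝ) : ℝ := derivWithin α (Set.Ioi x) x

/-- The left derivative of a function `α : ℝ → ℝ`. -/
def leftD (α : ℝ → ℝ) (x : ℝ) : ℝ := derivWithin α (Set.Iio x) x

/-- A Young function: an even, convex, nonnegative function, increasing on `[0,∞)`,
vanishing at `0` and with vanishing right derivative at `0`. -/
structure IsYoung (α : ℝ → ℝ) : Prop where
  nonneg : ∀ x, 0 ≤ α x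
  even : ∀ x, α (-x) = α x
  convex : ConvexOn ℝ Set.univ α
  mono : StrictMonoOn α (Set.Ici 0)
  zero : α 0 = 0
  rightD_zero : rightD α 0 = 0

/-- The Δ₂-condition for a Young function. -/
def DeltaTwo (α : ℝ → ℝ) : Prop := ∃ K > 0, ∀ x : ℝ, α (2 * x) ≤ K * α x

/-- `r_α = inf_{x>0} x α'₋(x)/α(x)`. -/
def rAlpha (α : ℝ → ℝ) : ℝ := sInf {r : ℝ | ∃ x > 0, r = x * leftD α x / α x}

/-- `p_α = sup_{x>0} x α'₊(x)/α(x)`. -/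
def pAlpha (α : ℝ → ℝ) : ℝ := sSup {r : ℝ | ∃ x > 0, r = x * rightD α x / α x}

/-- The Fenchel-Legendre transform `α*(y) = sup_x {xy - α(x)}`, with values in `[0,∞]`. -/
def legendre (α : ℝ → ℝ) (y : ℝ) : ℝ≥0∞ := ⨆ x : ℝ, ENNReal.ofReal (x * y - α x)

/-- `ξ_α(t) = sup_{u>0} α*(t α'₊(u)) / (t α(u))`. -/
def xiAlpha (α : ℝ → ℝ) (t : ℝ) : ℝ≥0∞ :=
  ⨆ u : {u : ℝ // 0 < u}, legendre α (t * rightD α u) / ENNReal.ofReal (t * α u)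

/-- A bounded real-valued function. -/
def IsBoundedFun {Y : Type*} (f : Y → ℝ) : Prop := ∃ M, ∀ x, |f x| ≤ M

variable {X : Type*} [MetricSpace X] [MeasurableSpace X]

/-- The optimal transport cost `T_α(ν,μ)` between two measures, for the cost
function `(x,y) ↦ α(d(x,y))`. -/
def transportCost (α : ℝ → ℝ) (ν μ : Measure X) : ℝ≥0∞ :=
  sInf { c : ℝ≥0∞ | ∃ π : Measure (X × X), π.map Prod.fst = ν ∧ π.map Prod.snd = μ ∧
      c = ∫⁻ z, ENNReal.ofReal (α (dist z.1 z.2)) ∂π }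

open Classical in
/-- The relative entropy `H(ν|μ) = ∫ log (dν/dμ) dν` if `ν ≪ μ` (and `+∞` if `ν` is not
absolutely continuous with respect to `μ`, or if the integral diverges). -/
def relEnt (ν μ : Measure X) : ℝ≥0∞ :=
  if ν ≪ μ ∧ Integrable (fun x => Real.log (ν.rnDeriv μ x).toReal) ν
  then ENNReal.ofReal (∫ x, Real.log (ν.rnDeriv μ x).toReal ∂ν) else ⊤

/-- The transport-entropy inequality `T_α(C)`: for every probability measure `ν`,
`T_α(ν,μ) ≤ C H(ν|μ)`. -/
def TransportEntropy (μ : Measure X) (α : ℝ → ℝ) (C : ℝ) : Prop :=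
  ∀ ν : Measure X, IsProbabilityMeasure ν →
    transportCost α ν μ ≤ ENNReal.ofReal C * relEnt ν μ

/-- The entropy functional `Ent_μ(e^f)`. -/
def entExp (μ : Measure X) (f : X → ℝ) : ℝ :=
  ∫ x, Real.exp (f x) * Real.log (Real.exp (f x)) ∂μ
    - (∫ x, Real.exp (f x) ∂μ) * Real.log (∫ x, Real.exp (f x) ∂μ)

/-- `|∇⁺ f|(x) = limsup_{y → x} [f(y) - f(x)]₊ / d(y,x)` (equal to `0` at isolated
points by the conventions on `limsup` and `sInf` in `ℝ`). -/
def gradPlus (f : X → ℝ) (x : X) : ℝ :=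
  limsup (fun y => max (f y - f x) 0 / dist y x) (𝓝[≠] x)

/-- `|∇⁻ f|(x) = limsup_{y → x} [f(y) - f(x)]₋ / d(y,x)` (equal to `0` at isolated
points by the conventions on `limsup` and `sInf` in `ℝ`). -/
def gradMinus (f : X → ℝ) (x : X) : ℝ :=
  limsup (fun y => max (-(f y - f x)) 0 / dist y x) (𝓝[≠] x)

/-- The modified log-Sobolev inequality plus `LSI⁺_α(A)`. -/
def LSIplus (μ : Measure X) (α : ℝ → ℝ) (A : ℝ) : Prop :=
  ∀ f : X → ℝ, IsBoundedFun f → LocallyLipschitz f →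
    ENNReal.ofReal (entExp μ f) ≤
      ENNReal.ofReal A * ∫⁻ x, legendre α (gradPlus f x) * ENNReal.ofReal (Real.exp (f x)) ∂μ

/-- The modified log-Sobolev inequality minus `LSI⁻_α(A)`. -/
def LSIminus (μ : Measure X) (α : ℝ → ℝ) (A : ℝ) : Prop :=
  ∀ f : X → ℝ, IsBoundedFun f → LocallyLipschitz f →
    ENNReal.ofReal (entExp μ f) ≤
      ENNReal.ofReal A * ∫⁻ x, legendre α (gradMinus f x) * ENNReal.ofReal (Real.exp (f x)) ∂μ

/-- The inf-convolution operator `Q_α^λ f(x) = inf_y {f(y) + λ α(d(x,y))}`. -/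
def QInf (α : ℝ → ℝ) (lam : ℝ) (f : X → ℝ) (x : X) : ℝ :=
  ⨅ y : X, (f y + lam * α (dist x y))

/-- The `(τ)`-log-Sobolev inequality `(τ)-LSI_α(λ, A)`. -/
def TauLSI (μ : Measure X) (α : ℝ → ℝ) (lam A : ℝ) : Prop :=
  ∀ f : X → ℝ, IsBoundedFun f → LocallyLipschitz f →
    entExp μ f ≤ A * ∫ x, (f x - QInf α lam f x) * Real.exp (f x) ∂μ

/-- The `n`-dimensional inf-convolution operator
`Q_{α,n} f(x) = inf_y {f(y) + Σᵢ α(d(xᵢ,yᵢ))}`. -/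
def QInfN (α : ℝ → ℝ) {n : ℕ} (f : (Fin n → X) → ℝ) (x : Fin n → X) : ℝ :=
  ⨅ y : Fin n → X, (f y + ∑ i, α (dist (x i) (y i)))

/-- The `n`-dimensional sup-convolution operator
`P_{α,n} f(x) = sup_y {f(y) - Σᵢ α(d(xᵢ,yᵢ))}`. -/
def PSupN (α : ℝ → ℝ) {n : ℕ} (f : (Fin n → X) → ℝ) (x : Fin n → X) : ℝ :=
  ⨆ y : Fin n → X, (f y - ∑ i, α (dist (x i) (y i)))

end

/-- The sup-convolution `P_s f(x) = sup_z {f(z) - s d(x,z)^p}`. -/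
noncomputable def supConv {X : Type*} [MetricSpace X] (p s : ℝ) (f : X → ℝ) (x : X) : ℝ :=
  ⨆ z : X, (f z - s * dist x z ^ p)

section SupConv

variable {X : Type*} [MetricSpace X] {p s B : ℝ} {f : X → ℝ}

lemma le_supConv (hs : 0 ≤ s) (hf : ∀ x, |f x| ≤ B) (x z : X) :
    f z - s * dist x z ^ p ≤ supConv p s f x := by
  refine le_ciSup (f := fun z => f z - s * dist x z ^ p) ⟨B, ?_⟩ z
  rintro _ ⟨y, rfl⟩
  have h₁ : 0 ≤ s * dist x y ^ p := by positivity
  have h₂ := (abs_le.1 (hf y)).2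
  simp only
  linarith

lemma supConv_le {c : ℝ} {x : X} (h : ∀ z, f z - s * dist x z ^ p ≤ c) : supConv p s f x ≤ c :=
  have : Nonempty X := ⟨x⟩
  ciSup_le h

lemma self_le_supConv (hp : 0 < p) (hs : 0 ≤ s) (hf : ∀ x, |f x| ≤ B) (x : X) :
    f x ≤ supConv p s f x := by
  simpa [Real.zero_rpow hp.ne'] using le_supConv (p := p) hs hf x x

lemma abs_supConv_le (hp : 0 < p) (hs : 0 ≤ s) (hf : ∀ x, |f x| ≤ B) (x : X) :
    |supConv p s f x| ≤ B := by
  refine abs_le.2 ⟨(abs_le.1 (hf x)).1.trans (self_le_supConv hp hs hf x), supConv_le fun z => ?_⟩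
  have h₁ : 0 ≤ s * dist x z ^ p := by positivity
  linarith [(abs_le.1 (hf z)).2]

lemma supConv_anti {s' : ℝ} (hs' : 0 ≤ s') (hs : s' ≤ s) (hf : ∀ x, |f x| ≤ B) (x : X) :
    supConv p s f x ≤ supConv p s' f x :=
  supConv_le fun z => le_trans (by gcongr) (le_supConv hs' hf x z)

lemma add_rpow_sub_rpow_le (hp : 1 ≤ p) {D a : ℝ} (hD : 0 ≤ D) (ha : 0 ≤ a) :
    (D + a) ^ p - D ^ p ≤ p * (D + a) ^ (p - 1) * a := by
  rcases (add_nonneg hD ha).eq_or_lt with h | h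
  · obtain rfl : a = 0 := by linarith
    simp
  have h₁ : -1 ≤ -a / (D + a) := by rw [le_div_iff₀ h]; linarith
  have h₂ := one_add_mul_self_le_rpow_one_add h₁ hp
  have h₃ : 1 + -a / (D + a) = D / (D + a) := by field_simp; ring
  rw [h₃, Real.div_rpow hD h.le, le_div_iff₀ (by positivity)] at h₂
  have h₄ : (D + a) ^ p = (D + a) ^ (p - 1) * (D + a) := by
    rw [← Real.rpow_add_one h.ne']; ring_nf
  have h₅ : (1 + p * (-a / (D + a))) * (D + a) ^ p
      = (D + a) ^ p - p * (D + a) ^ (p - 1) * a := by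
    rw [h₄]; field_simp
    ring
  linarith

lemma supConv_le_add_mul_dist (hp : 1 ≤ p) (hs : 0 < s) (hf : ∀ x, |f x| ≤ B) {x y : X}
    (hxy : dist x y ≤ 1) :
    supConv p s f x ≤ supConv p s f y
      + s * (p * (max 1 (2 * B / s) + 1) ^ (p - 1)) * dist x y := by
  set R := max 1 (2 * B / s)
  have hR : 1 ≤ R := le_max_left _ _
  have hK : 0 ≤ s * (p * (R + 1) ^ (p - 1)) * dist x y := by positivity
  refine supConv_le fun z => ?_
  rcases le_or_gt (dist x z) R with hz | hz
  · have h₁ := le_supConv (p := p) hs.le hf y z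
    have h₂ : dist y z ^ p ≤ (dist x z + dist x y) ^ p := by
      gcongr
      rw [dist_comm x y, add_comm]
      exact dist_triangle y x z
    have h₃ := add_rpow_sub_rpow_le hp (dist_nonneg (x := x) (y := z)) (dist_nonneg (x := x) (y := y))
    have h₄ : p * (dist x z + dist x y) ^ (p - 1) * dist x y
        ≤ p * (R + 1) ^ (p - 1) * dist x y := by
      have : 0 ≤ p - 1 := by linarith
      gcongr
    have h₅ : s * (dist y z ^ p - dist x z ^ p) ≤ s * (p * (R + 1) ^ (p - 1) * dist x y) := by
      gcongr
      linarith
    linarith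
  · have h₁ : R ≤ dist x z ^ p :=
      hz.le.trans (Real.self_le_rpow_of_one_le (hR.trans hz.le) hp)
    have h₂ : 2 * B / s ≤ dist x z ^ p := (le_max_right _ _).trans h₁
    rw [div_le_iff₀ hs] at h₂
    have h₃ := (abs_le.1 (abs_supConv_le (p := p) (by linarith) hs.le hf y)).1
    have h₄ := (abs_le.1 (hf z)).2
    linarith

lemma locallyLipschitz_supConv (hp : 1 ≤ p) (hs : 0 < s) (hf : ∀ x, |f x| ≤ B) :
    LocallyLipschitz (supConv p s f) := by
  intro x
  refine ⟨(s * (p * (max 1 (2 * B / s) + 1) ^ (p - 1))).toNNReal, Metric.ball x (1 / 2),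
    Metric.ball_mem_nhds x (by norm_num), LipschitzOnWith.of_le_add_mul _ fun y hy z hz => ?_⟩
  rw [Real.coe_toNNReal _ (by positivity)]
  refine supConv_le_add_mul_dist hp hs hf ?_
  have := dist_triangle_right y z x
  rw [Metric.mem_ball] at hy hz
  linarith

lemma qInf_eq_neg_supConv (g : X → ℝ) (x : X) :
    QInf (fun r => |r| ^ p) 1 g x = -supConv p 1 (fun z => -g z) x := by
  unfold QInf supConv
  rw [iInf, iSup, ← Real.sInf_neg]
  congr 1
  ext r
  simp only [Set.mem_range, Set.mem_neg]
  refine exists_congr fun y => ?_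
  rw [abs_of_nonneg dist_nonneg]
  constructor <;> intro h <;> linarith

lemma mul_rpow_add_sub_le {v D a : ℝ} (hp : 1 ≤ p) (hv₀ : 0 < v) (hv₁ : v < 1) (hD : 0 ≤ D)
    (ha : 0 ≤ a) :
    v ^ (p - 1) * ((D + a) ^ p - D ^ p) - a ^ p
      ≤ v ^ (p - 1) * ((1 - v) ^ (-(p - 1)) - 1) * D ^ p := by
  have hw : 0 < 1 - v := by linarith
  have h := (convexOn_rpow hp).2 (x := D / (1 - v)) (y := a / v) (Set.mem_Ici.2 (by positivity))
    (Set.mem_Ici.2 (by positivity)) hw.le hv₀.le (by ring)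
  simp only [smul_eq_mul] at h
  rw [mul_div_cancel₀ _ hw.ne', mul_div_cancel₀ _ hv₀.ne', Real.div_rpow hD hw.le,
    Real.div_rpow ha hv₀.le] at h
  have e₁ : (1 - v) * (D ^ p / (1 - v) ^ p) = (1 - v) ^ (-(p - 1)) * D ^ p := by
    rw [Real.rpow_neg hw.le, Real.rpow_sub_one hw.ne']; field_simp
  have e₂ : v * (a ^ p / v ^ p) = a ^ p / v ^ (p - 1) := by
    rw [Real.rpow_sub_one hv₀.ne']; field_simp
  rw [e₁, e₂] at h
  have hu : 0 < v ^ (p - 1) := by positivity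
  have h' := mul_le_mul_of_nonneg_left h hu.le
  rw [mul_add, mul_div_cancel₀ _ hu.ne'] at h'
  linarith

lemma sub_qInf_supConv_le (hp : 1 ≤ p) {k s' v : ℝ} (hk : 0 < k) (hs : 0 < s) (hs' : 0 ≤ s')
    (hs's : s' ≤ s) (hv₀ : 0 < v) (hv₁ : v < 1) (hv : k * s = v ^ (p - 1))
    (hf : ∀ x, |f x| ≤ B) (x : X) :
    (s - s') * (k * supConv p s f x - QInf (fun r => |r| ^ p) 1 (fun y => k * supConv p s f y) x)
      ≤ k * s * ((1 - v) ^ (-(p - 1)) - 1) * (supConv p s' f x - supConv p s f x) := by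
  have : Nonempty X := ⟨x⟩
  set E := (1 - v) ^ (-(p - 1)) - 1
  have hE : 0 ≤ E :=
    sub_nonneg.2 (Real.one_le_rpow_of_pos_of_le_one_of_nonpos (by linarith) (by linarith)
      (by linarith))
  rcases hs's.eq_or_lt with rfl | hlt
  · simp
  have hh : 0 < s - s' := sub_pos.2 hlt
  rw [qInf_eq_neg_supConv, sub_neg_eq_add, ← le_div_iff₀' hh, ← le_sub_iff_add_le']
  refine supConv_le fun y => ?_
  have hpos : 0 < (s - s') * k + k * s * E := by positivity
  have key : supConv p s f x ≤ (k * s * E * supConv p s' f x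
      + (s - s') * (k * supConv p s f y + dist x y ^ p)) / ((s - s') * k + k * s * E) := by
    refine supConv_le fun z => ?_
    rw [le_div_iff₀ hpos]
    have h₁ := le_supConv (p := p) hs' hf x z
    have h₂ := le_supConv (p := p) hs.le hf y z
    have h₃ := mul_rpow_add_sub_le hp hv₀ hv₁ (dist_nonneg (x := x) (y := z))
      (dist_nonneg (x := x) (y := y))
    have h₄ : dist y z ^ p ≤ (dist x z + dist x y) ^ p := by
      gcongr
      rw [dist_comm x y, add_comm]
      exact dist_triangle y x z
    rw [← hv] at h₃
    have h₅ : k * (f z - s * dist x z ^ p) - k * supConv p s f y - dist x y ^ p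
        ≤ k * s * E * dist x z ^ p := by
      have h₆ := mul_le_mul_of_nonneg_left h₂ hk.le
      have h₇ := mul_le_mul_of_nonneg_left h₄ (mul_pos hk hs).le
      linarith
    have h₈ := mul_le_mul_of_nonneg_left h₅ hh.le
    have h₉ := mul_le_mul_of_nonneg_left h₁ (show 0 ≤ k * s * E by positivity)
    linarith
  rw [le_div_iff₀ hpos] at key
  rw [one_mul, le_sub_iff_add_le, le_div_iff₀' hh]
  linarith

end SupConv

section FreeEnergy

variable {X : Type*} [MetricSpace X] [MeasurableSpace X] [BorelSpace X]
  {μ : Measure X} [IsProbabilityMeasure μ]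

lemma integrable_of_continuous_of_abs_le {g : X → ℝ} {B : ℝ} (hg : Continuous g)
    (hB : ∀ x, |g x| ≤ B) : Integrable g μ :=
  have := hg.measurable
  Integrable.of_bound this.aestronglyMeasurable B (ae_of_all _ hB)

lemma integrable_mul_exp_of_continuous_of_abs_le {g h : X → ℝ} {B C : ℝ} (hg : Continuous g)
    (hgB : ∀ x, |g x| ≤ B) (hh : Continuous h) (hhC : ∀ x, |h x| ≤ C) :
    Integrable (fun x => h x * Real.exp (g x)) μ := by
  refine integrable_of_continuous_of_abs_le (B := C * Real.exp B) (by fun_prop) fun x => ?_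
  rw [abs_mul, Real.abs_exp]
  have := (abs_nonneg _).trans (hhC x)
  gcongr
  · exact hhC x
  · exact (abs_le.1 (hgB x)).2

lemma integrable_exp_of_continuous_of_abs_le {g : X → ℝ} {B : ℝ} (hg : Continuous g)
    (hgB : ∀ x, |g x| ≤ B) : Integrable (fun x => Real.exp (g x)) μ := by
  simpa using integrable_mul_exp_of_continuous_of_abs_le (μ := μ) hg hgB
    (continuous_const (y := (1 : ℝ))) (C := 1) (by simp)

lemma log_integral_exp_add_le {g g' : X → ℝ} {B B' : ℝ} (hg : Continuous g)
    (hgB : ∀ x, |g x| ≤ B) (hg' : Continuous g') (hgB' : ∀ x, |g' x| ≤ B') :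
    Real.log (∫ x, Real.exp (g x) ∂μ)
        + (∫ x, (g' x - g x) * Real.exp (g x) ∂μ) / ∫ x, Real.exp (g x) ∂μ
      ≤ Real.log (∫ x, Real.exp (g' x) ∂μ) := by
  have hi := integrable_exp_of_continuous_of_abs_le (μ := μ) hg hgB
  have hi' := integrable_exp_of_continuous_of_abs_le (μ := μ) hg' hgB'
  have hZ : 0 < ∫ x, Real.exp (g x) ∂μ := integral_exp_pos hi
  have hd : Integrable (fun x => (g' x - g x) * Real.exp (g x)) μ :=
    integrable_mul_exp_of_continuous_of_abs_le hg hgB (hg'.sub hg) (C := B' + B)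
      fun x => (abs_sub _ _).trans (add_le_add (hgB' x) (hgB x))
  set Z := ∫ x, Real.exp (g x) ∂μ
  set m := (∫ x, (g' x - g x) * Real.exp (g x) ∂μ) / Z with hm
  rw [Real.le_log_iff_exp_le (integral_exp_pos hi'), Real.exp_add, Real.exp_log hZ]
  have hpt : ∀ x, Real.exp m * ((g' x - g x) * Real.exp (g x) + (1 - m) * Real.exp (g x))
      ≤ Real.exp (g' x) := by
    intro x
    have h₁ := Real.add_one_le_exp (g' x - g x - m)
    have h₂ : Real.exp (g' x) = Real.exp m * (Real.exp (g x) * Real.exp (g' x - g x - m)) := by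
      rw [← Real.exp_add, ← Real.exp_add]; ring_nf
    rw [h₂, ← add_mul, mul_comm _ (Real.exp (g x))]
    gcongr
    linarith
  have h := integral_mono ((hd.add (hi.const_mul (1 - m))).const_mul (Real.exp m)) hi' hpt
  refine le_trans (le_of_eq ?_) h
  simp only [Pi.add_apply]
  rw [integral_const_mul, integral_add hd (hi.const_mul _), integral_const_mul]
  have : ∫ x, (g' x - g x) * Real.exp (g x) ∂μ = m * Z := by rw [hm]; field_simp
  rw [this]
  ring

/-- One backward step along a path `(k, s)`: the free energy `k⁻¹ log ∫ exp (k P_s f)` does not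
decrease when `k` and `s` decrease, as long as `s` decreases fast enough. -/
lemma log_integral_exp_supConv_div_le {p A M B k k' s s' v : ℝ} {f : X → ℝ} (hp : 1 ≤ p)
    (hLSI : TauLSI μ (fun x => |x| ^ p) 1 A) (hAM : A ≤ M) (hM : 0 ≤ M)
    (hf : ∀ x, |f x| ≤ B) (hk' : 0 < k') (hk : k' ≤ k) (hs' : 0 < s') (hs : s' < s)
    (hv₀ : 0 < v) (hv₁ : v < 1) (hv : k * s = v ^ (p - 1))
    (hstep : (k - k') * (M * ((1 - v) ^ (-(p - 1)) - 1) * s) ≤ k' * (s - s')) :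
    Real.log (∫ x, Real.exp (k * supConv p s f x) ∂μ) / k
      ≤ Real.log (∫ x, Real.exp (k' * supConv p s' f x) ∂μ) / k' := by
  have hk₀ : 0 < k := hk'.trans_le hk
  have hs₀ : 0 < s := hs'.trans hs
  set E := (1 - v) ^ (-(p - 1)) - 1
  set P := supConv p s f with hP
  set P' := supConv p s' f with hP'
  have hPl : LocallyLipschitz P := locallyLipschitz_supConv hp hs₀ hf
  have hPc : Continuous P := hPl.continuous
  have hPc' : Continuous P' := (locallyLipschitz_supConv hp hs' hf).continuous
  have hPB : ∀ x, |P x| ≤ B := abs_supConv_le (by linarith) hs₀.le hf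
  have hPB' : ∀ x, |P' x| ≤ B := abs_supConv_le (by linarith) hs'.le hf
  have hkB : ∀ x, |k * P x| ≤ k * B := fun x => by
    rw [abs_mul, abs_of_pos hk₀]; gcongr; exact hPB x
  have hkB' : ∀ x, |k' * P' x| ≤ k' * B := fun x => by
    rw [abs_mul, abs_of_pos hk']; gcongr; exact hPB' x
  have hkc : Continuous fun x => k * P x := by fun_prop
  have hnB : ∀ x, |-(k * P x)| ≤ k * B := fun x => by rw [abs_neg]; exact hkB x
  have hQeq : QInf (fun r => |r| ^ p) 1 (fun y => k * P y)
      = fun x => -supConv p 1 (fun z => -(k * P z)) x := funext (qInf_eq_neg_supConv _)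
  set Q := QInf (fun r => |r| ^ p) 1 (fun y => k * P y) with hQ
  have hQc : Continuous Q := by
    rw [hQeq]; exact (locallyLipschitz_supConv hp one_pos hnB).continuous.neg
  have hQB : ∀ x, |Q x| ≤ k * B := fun x => by
    rw [hQeq]; simp only [abs_neg]
    exact abs_supConv_le (by linarith) zero_le_one hnB x
  have hQle : ∀ x, 0 ≤ k * P x - Q x := fun x => by
    have := self_le_supConv (p := p) (by linarith) zero_le_one hnB x
    rw [hQeq]; linarith
  have hQB₂ : ∀ x, |k * P x - Q x| ≤ k * B + k * B := fun x =>
    (abs_sub _ _).trans (add_le_add (hkB x) (hQB x))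
  have iZ := integrable_exp_of_continuous_of_abs_le (μ := μ) hkc hkB
  have i₁ := integrable_mul_exp_of_continuous_of_abs_le (μ := μ) hkc hkB hPc hPB
  have i₂ := integrable_mul_exp_of_continuous_of_abs_le (μ := μ) hkc hkB hPc' hPB'
  have iQ := integrable_mul_exp_of_continuous_of_abs_le (μ := μ) hkc hkB (hkc.sub hQc) hQB₂
  have hlsi := hLSI (fun x => k * P x) ⟨_, hkB⟩ 
    ((lipschitzWith_smul k).locallyLipschitz.comp hPl)
  have hjen := log_integral_exp_add_le (μ := μ) hkc hkB (hPc'.const_mul k') hkB'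
  set Z := ∫ x, Real.exp (k * P x) ∂μ
  have hZ : 0 < Z := integral_exp_pos iZ
  set I₁ := ∫ x, P x * Real.exp (k * P x) ∂μ with hI₁
  set I₂ := ∫ x, P' x * Real.exp (k * P x) ∂μ with hI₂
  have hI : I₁ ≤ I₂ := integral_mono i₁ i₂ fun x => by
    have := supConv_anti (p := p) hs'.le hs.le hf x
    simp only
    gcongr
  have hent : entExp μ (fun x => k * P x) = k * I₁ - Z * Real.log Z := by
    unfold entExp
    simp only [Real.log_exp]
    rw [hI₁, ← integral_const_mul]
    congr 1
    exact integral_congr_ae (ae_of_all _ fun x => by ring)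
  have hdef : (s - s') * ∫ x, (k * P x - Q x) * Real.exp (k * P x) ∂μ
      ≤ k * s * E * (I₂ - I₁) := by
    rw [hI₁, hI₂, ← integral_sub i₂ i₁, ← integral_const_mul, ← integral_const_mul]
    refine integral_mono (iQ.const_mul _) ((i₂.sub i₁).const_mul _) fun x => ?_
    have := mul_le_mul_of_nonneg_right
      (sub_qInf_supConv_le hp hk₀ hs₀ hs'.le hs.le hv₀ hv₁ hv hf x) (Real.exp_pos (k * P x)).le
    simp only
    calc _ = _ := by rw [← mul_assoc]
      _ ≤ _ := this
      _ = _ := by ring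
  have hnum : ∫ x, (k' * P' x - k * P x) * Real.exp (k * P x) ∂μ = k' * I₂ - k * I₁ := by
    rw [hI₁, hI₂, ← integral_const_mul, ← integral_const_mul,
      ← integral_sub (i₂.const_mul _) (i₁.const_mul _)]
    exact integral_congr_ae (ae_of_all _ fun x => by ring)
  rw [hent] at hlsi
  rw [hnum] at hjen
  have hD₀ : 0 ≤ ∫ x, (k * P x - Q x) * Real.exp (k * P x) ∂μ :=
    integral_nonneg fun x => mul_nonneg (hQle x) (Real.exp_pos _).le
  set D := ∫ x, (k * P x - Q x) * Real.exp (k * P x) ∂μ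
  have hh : 0 < s - s' := sub_pos.2 hs
  have hlsi' : k * I₁ - Z * Real.log Z ≤ M * D :=
    hlsi.trans (mul_le_mul_of_nonneg_right hAM hD₀)
  have hmain : 0 ≤ (k - k') * (Z * Real.log Z) + k * (k' * I₂ - k * I₁) := by
    have h₁ : (k - k') * ((s - s') * (M * D)) ≤ k * (k' * (s - s')) * (I₂ - I₁) := by
      calc (k - k') * ((s - s') * (M * D)) = (k - k') * M * ((s - s') * D) := by ring
        _ ≤ (k - k') * M * (k * s * E * (I₂ - I₁)) :=
          mul_le_mul_of_nonneg_left hdef (mul_nonneg (sub_nonneg.2 hk) hM)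
        _ = k * ((k - k') * (M * E * s)) * (I₂ - I₁) := by ring
        _ ≤ k * (k' * (s - s')) * (I₂ - I₁) :=
          mul_le_mul_of_nonneg_right (mul_le_mul_of_nonneg_left hstep hk₀.le)
            (sub_nonneg.2 hI)
    have h₂ : (k - k') * (M * D) ≤ k * k' * (I₂ - I₁) :=
      le_of_mul_le_mul_left (by linarith) hh
    have h₃ := mul_le_mul_of_nonneg_left hlsi' (sub_nonneg.2 hk)
    linarith
  rw [div_le_div_iff₀ hk₀ hk']
  have h₄ := mul_le_mul_of_nonneg_left hjen hk₀.le
  have h₅ : 0 ≤ (k - k') * Real.log Z + k * ((k' * I₂ - k * I₁) / Z) := by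
    have := div_nonneg hmain hZ.le
    rwa [add_div, mul_div_assoc, mul_div_cancel_left₀ _ hZ.ne', mul_div_assoc k] at this
  linarith

end FreeEnergy

lemma one_sub_rpow_neg_sub_one_le {n v x : ℝ} (hn : 1 ≤ n) (hv : 0 ≤ v) (hvx : v ≤ x)
    (hx₀ : 0 < x) (hx : x < 1) :
    (1 - v) ^ (-n) - 1 ≤ v / x * ((1 - x) ^ (-n) - 1) := by
  have hv1 : 0 < 1 - v := by linarith
  have hx1 : 0 < 1 - x := by linarith
  have hθ : v / x ≤ 1 := (div_le_one hx₀).2 hvx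
  have h := (convexOn_rpow hn).2 (x := 1) (y := (1 - x)⁻¹) (Set.mem_Ici.2 (by positivity))
    (Set.mem_Ici.2 (by positivity)) (sub_nonneg.2 hθ) (div_nonneg hv hx₀.le) (by ring)
  simp only [smul_eq_mul, Real.one_rpow] at h
  have h₁ : (1 - v)⁻¹ ≤ (1 - v / x) * 1 + v / x * (1 - x)⁻¹ := by
    have : (1 - v / x) * 1 + v / x * (1 - x)⁻¹ = (1 - x + v) / (1 - x) := by
      field_simp; ring
    rw [this, inv_eq_one_div, div_le_div_iff₀ hv1 hx1]
    nlinarith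
  have h₂ := Real.rpow_le_rpow (by positivity) h₁ (by linarith : 0 ≤ n)
  rw [Real.rpow_neg hv1.le, Real.rpow_neg hx1.le, ← Real.inv_rpow hv1.le, ← Real.inv_rpow hx1.le]
  linarith

lemma mul_le_one_sub_rpow_neg_sub_one {n v : ℝ} (hn : 1 ≤ n) (hv : 0 ≤ v) (hv₁ : v < 1) :
    n * v ≤ (1 - v) ^ (-n) - 1 := by
  have h0 : 0 < 1 - v := by linarith
  have h₁ : 1 + v ≤ (1 - v)⁻¹ := by
    rw [inv_eq_one_div, le_div_iff₀ h0]; nlinarith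
  have h₂ := one_add_mul_self_le_rpow_one_add (by linarith : -1 ≤ v) hn
  have h₃ := Real.rpow_le_rpow (by linarith) h₁ (by linarith : 0 ≤ n)
  rw [Real.rpow_neg h0.le, ← Real.inv_rpow h0.le]
  linarith

/-- Along the path `s = (1 + L v)^n`, `k = (v / (1 + L v))^n`, short steps from `v` to `w < v`
are admissible as soon as `e ≤ L₀ v` with `L₀ < L`. -/
lemma path_step {n v w e L L₀ : ℝ} (hn : 1 ≤ n) (hw : 0 < w) (hwv : w < v) (hL₀ : 0 ≤ L₀)
    (hL : 0 < L) (he : 0 ≤ e) (hev : e ≤ L₀ * v) (hz : n * (v - w) / w ≤ 1)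
    (hzL : 3 * (n * (v - w) / w) * L₀ * (1 + L * w) ≤ L - L₀) :
    ((v / (1 + L * v)) ^ n - (w / (1 + L * w)) ^ n) * (e * (1 + L * v) ^ n)
      ≤ (w / (1 + L * w)) ^ n * ((1 + L * v) ^ n - (1 + L * w) ^ n) := by
  have hn₀ : 0 < n := by linarith
  have hv : 0 < v := hw.trans hwv
  set z := n * (v - w) / w with hzdef
  have hz₀ : 0 < z := div_pos (mul_pos hn₀ (sub_pos.2 hwv)) hw
  have hσ : 0 < 1 + L * v := by positivity
  have hσ' : 0 < 1 + L * w := by positivity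
  have hvz : v = w * (1 + z / n) := by rw [hzdef]; field_simp; ring
  have ha : (v / w) ^ n ≤ 1 + z + z ^ 2 := by
    have h₁ : v / w ≤ Real.exp (z / n) := by
      have := Real.add_one_le_exp (z / n)
      rw [hvz, mul_div_cancel_left₀ _ hw.ne']
      linarith
    have h₂ := Real.rpow_le_rpow (by positivity) h₁ hn₀.le
    rw [← Real.exp_mul, div_mul_cancel₀ _ hn₀.ne'] at h₂
    have h₃ := Real.abs_exp_sub_one_sub_id_le (x := z) (by rwa [abs_of_pos hz₀])
    have h₄ := (abs_le.1 h₃).2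
    linarith
  have hb : 1 + z * w * L / (1 + L * w) ≤ ((1 + L * v) / (1 + L * w)) ^ n := by
    have h₁ : (1 + L * v) / (1 + L * w) = 1 + L * (v - w) / (1 + L * w) := by
      field_simp; ring
    have h₂ : 0 ≤ L * (v - w) / (1 + L * w) :=
      div_nonneg (mul_nonneg hL.le (sub_pos.2 hwv).le) hσ'.le
    rw [h₁]
    refine le_trans (le_of_eq ?_) (one_add_mul_self_le_rpow_one_add (by linarith) hn)
    rw [hzdef]; field_simp
  have hkey : e * ((v / w) ^ n - ((1 + L * v) / (1 + L * w)) ^ n)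
      ≤ ((1 + L * v) / (1 + L * w)) ^ n - 1 := by
    set a := (v / w) ^ n
    set b := ((1 + L * v) / (1 + L * w)) ^ n
    have hb₀ : 0 ≤ z * w * L / (1 + L * w) := by positivity
    rcases le_or_gt a b with hab | hab
    · nlinarith
    have h₁ : e * (a - b) ≤ L₀ * v * (a - b) := by
      gcongr
    have h₂ : L₀ * v * (z + z ^ 2) ≤ (1 + L₀ * v) * (z * w * L / (1 + L * w)) := by
      rw [← mul_div_assoc, le_div_iff₀ hσ']
      have h₃ : v ≤ w * (1 + z) := by
        rw [hvz]; gcongr; exact div_le_self hz₀.le hn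
      have h₄ : v * (1 + z) ≤ w * (1 + 3 * z) := by
        calc v * (1 + z) ≤ w * (1 + z) * (1 + z) := by gcongr
          _ ≤ w * (1 + 3 * z) := by
            rw [mul_assoc]; gcongr; nlinarith
      calc L₀ * v * (z + z ^ 2) * (1 + L * w) = L₀ * z * (1 + L * w) * (v * (1 + z)) := by ring
        _ ≤ L₀ * z * (1 + L * w) * (w * (1 + 3 * z)) := by gcongr
        _ = z * w * (L₀ * (1 + L * w) + 3 * z * L₀ * (1 + L * w)) := by ring
        _ ≤ z * w * (L₀ * (1 + L * w) + (L - L₀)) := by gcongr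
        _ = (1 + L₀ * w) * (z * w * L) := by ring
        _ ≤ (1 + L₀ * v) * (z * w * L) := by gcongr
    have h₅ : L₀ * v * (a - 1) ≤ L₀ * v * (z + z ^ 2) := by gcongr; linarith
    have h₆ : (1 + L₀ * v) * (z * w * L / (1 + L * w)) ≤ (1 + L₀ * v) * (b - 1) := by
      gcongr; linarith
    linarith
  have hw' : 0 < w ^ n := by positivity
  have h := mul_le_mul_of_nonneg_left hkey hw'.le
  rw [Real.div_rpow hv.le hσ.le, Real.div_rpow hw.le hσ'.le]
  rw [Real.div_rpow hv.le hw.le, Real.div_rpow hσ.le hσ'.le] at h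
  have hs : 0 < (1 + L * v) ^ n := by positivity
  have hs' : 0 < (1 + L * w) ^ n := by positivity
  refine le_trans (le_of_eq ?_) (h.trans (le_of_eq ?_))
  · field_simp
  · field_simp

lemma le_of_forall_short_step {F : ℝ → ℝ} {a b δ : ℝ} (hab : a ≤ b) (hδ : 0 < δ)
    (h : ∀ w v, a ≤ w → w < v → v ≤ b → v - w ≤ δ → F v ≤ F w) : F b ≤ F a := by
  have key : ∀ N : ℕ, ∀ c, a ≤ c → c ≤ b → c - a ≤ N * δ → F c ≤ F a := by
    intro N
    induction N with
    | zero =>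
      intro c hac _ hN
      have : c = a := by
        rw [Nat.cast_zero, zero_mul] at hN
        linarith
      rw [this]
    | succ N ih =>
      intro c hac hcb hN
      push_cast at hN
      rcases hac.eq_or_lt with rfl | hlt
      · exact le_rfl
      rcases le_or_gt (c - a) δ with hc | hc
      · exact h a c le_rfl hlt hcb hc
      · exact (h (c - δ) c (by linarith) (by linarith) hcb (by linarith)).trans
          (ih (c - δ) (by linarith) (by linarith) (by linarith))
  obtain ⟨N, hN⟩ := exists_nat_ge ((b - a) / δ)
  exact key N b hab le_rfl ((div_le_iff₀ hδ).1 hN)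

section FreeEnergy

variable {X : Type*} [MetricSpace X] [MeasurableSpace X] [BorelSpace X]
  {μ : Measure X} [IsProbabilityMeasure μ]

lemma log_integral_exp_mul_div_le {g : X → ℝ} {B k : ℝ} (hg : Continuous g)
    (hB : ∀ x, |g x| ≤ B) (hk : 0 < k) (hkB : k * B ≤ 1) :
    Real.log (∫ x, Real.exp (k * g x) ∂μ) / k ≤ ∫ x, g x ∂μ + k * B ^ 2 := by
  have hkg : ∀ x, |k * g x| ≤ k * B := fun x => by
    rw [abs_mul, abs_of_pos hk]; gcongr; exact hB x
  have ig := integrable_of_continuous_of_abs_le (μ := μ) hg hB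
  have ie := integrable_exp_of_continuous_of_abs_le (μ := μ) (hg.const_mul k) hkg
  have hpt : ∀ x, Real.exp (k * g x) ≤ k * g x + (1 + (k * B) ^ 2) := fun x => by
    have h₁ := (abs_le.1 (Real.abs_exp_sub_one_sub_id_le ((hkg x).trans hkB))).2
    have h₂ : (k * g x) ^ 2 ≤ (k * B) ^ 2 := sq_le_sq' (abs_le.1 (hkg x)).1 (abs_le.1 (hkg x)).2
    linarith
  have h := integral_mono ie ((ig.const_mul k).add (integrable_const _)) hpt
  simp only [Pi.add_apply] at h
  rw [integral_add (ig.const_mul k) (integrable_const _), integral_const_mul] at h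
  simp only [integral_const, probReal_univ, one_smul] at h
  have hlog := Real.log_le_sub_one_of_pos (integral_exp_pos ie)
  rw [div_le_iff₀ hk]
  linarith

theorem log_integral_exp_le_of_tauLSI {p A M B L L₀ v₁ : ℝ} {f : X → ℝ} (hp : 2 ≤ p)
    (hLSI : TauLSI μ (fun x => |x| ^ p) 1 A) (hAM : A ≤ M) (hM : 0 ≤ M)
    (hfc : Continuous f) (hf : ∀ x, |f x| ≤ B) (hv₀ : 0 < v₁) (hv₁ : v₁ < 1)
    (hL₀ : 0 ≤ L₀) (hL : L₀ < L)
    (hE : ∀ v, 0 < v → v ≤ v₁ → M * ((1 - v) ^ (-(p - 1)) - 1) ≤ L₀ * v) :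
    Real.log (∫ x, Real.exp ((v₁ / (1 + L * v₁)) ^ (p - 1) * f x) ∂μ)
      ≤ (v₁ / (1 + L * v₁)) ^ (p - 1) * ∫ x, supConv p 1 f x ∂μ := by
  have hn : 1 ≤ p - 1 := by linarith
  have hn₀ : 0 < p - 1 := by linarith
  have hLpos : 0 < L := hL₀.trans_lt hL
  set k : ℝ → ℝ := fun v => (v / (1 + L * v)) ^ (p - 1) with hkdef
  set s : ℝ → ℝ := fun v => (1 + L * v) ^ (p - 1) with hsdef
  have hσ : ∀ v, 0 < v → 1 < 1 + L * v := fun v hv => by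
    have := mul_pos hLpos hv
    linarith
  have hk : ∀ v, 0 < v → 0 < k v := fun v hv => by
    have := hσ v hv
    simp only [hkdef]; positivity
  have hs : ∀ v, 0 < v → 1 ≤ s v := fun v hv => Real.one_le_rpow (hσ v hv).le hn₀.le
  set F : ℝ → ℝ := fun v => Real.log (∫ x, Real.exp (k v * supConv p (s v) f x) ∂μ) / k v
    with hF
  have hB : 0 ≤ B := by
    have : Nonempty X := nonempty_of_isProbabilityMeasure μ
    exact (abs_nonneg _).trans (hf this.some)
  have hmono : ∀ a, 0 < a → a ≤ v₁ → F v₁ ≤ F a := by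
    intro a ha hav
    set δ := min (a / (p - 1)) ((L - L₀) * a / (3 * (p - 1) * (L₀ + 1) * (1 + L * v₁)))
    have h1 := hσ v₁ hv₀
    have hLL : 0 < L - L₀ := sub_pos.2 hL
    have hδ : 0 < δ := lt_min (by positivity) (by positivity)
    refine le_of_forall_short_step hav hδ fun w v haw hwv hvv hd => ?_
    have hw : 0 < w := ha.trans_le haw
    have hv : 0 < v := hw.trans hwv
    have hd₁ := hd.trans (min_le_left _ _)
    have hd₂ := hd.trans (min_le_right _ _)
    have hE₀ : 0 ≤ (1 - v) ^ (-(p - 1)) - 1 :=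
      (by positivity : 0 ≤ (p - 1) * v).trans
        (mul_le_one_sub_rpow_neg_sub_one hn hv.le (by linarith))
    have hks : k v * s v = v ^ (p - 1) := by
      have := hσ v hv
      simp only [hkdef, hsdef]
      rw [← Real.mul_rpow (by positivity) (by positivity), div_mul_cancel₀ _ (by positivity)]
    have hkmono : k w ≤ k v := by
      have h2 := hσ v hv
      have h3 := hσ w hw
      refine Real.rpow_le_rpow (by positivity) ?_ hn₀.le
      rw [div_le_div_iff₀ (by positivity) (by positivity)]
      linarith
    have hsmono : s w < s v := by
      have h3 := hσ w hw
      refine Real.rpow_lt_rpow (by positivity) ?_ hn₀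
      gcongr
    refine log_integral_exp_supConv_div_le (by linarith) hLSI hAM hM hf (hk w hw) hkmono
      (by linarith [hs w hw]) hsmono hv (by linarith) hks ?_
    have hvw : 0 < v - w := sub_pos.2 hwv
    refine path_step hn hw hwv hL₀ hLpos (mul_nonneg hM hE₀) (hE v hv hvv) ?_ ?_
    · rw [div_le_one hw]
      rw [le_div_iff₀ hn₀] at hd₁
      linarith
    · rw [le_div_iff₀ (by positivity)] at hd₂
      calc 3 * ((p - 1) * (v - w) / w) * L₀ * (1 + L * w)
          ≤ 3 * ((p - 1) * (v - w) / a) * (L₀ + 1) * (1 + L * v₁) := by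
            gcongr
            · linarith
            · linarith
        _ = (v - w) * (3 * (p - 1) * (L₀ + 1) * (1 + L * v₁)) / a := by ring
        _ ≤ L - L₀ := by rw [div_le_iff₀ ha]; exact hd₂
  have hlim : F v₁ ≤ ∫ x, supConv p 1 f x ∂μ := by
    refine le_of_forall_pos_le_add fun ε hε => ?_
    set a := min v₁ (min (1 / (B + 1)) (ε / (B ^ 2 + 1)))
    have ha : 0 < a := lt_min hv₀ (lt_min (by positivity) (by positivity))
    have hav : a ≤ v₁ := min_le_left _ _
    have ha₁ : a ≤ 1 / (B + 1) := (min_le_right _ _).trans (min_le_left _ _)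
    have ha₂ : a ≤ ε / (B ^ 2 + 1) := (min_le_right _ _).trans (min_le_right _ _)
    have hka : k a ≤ a := by
      have h2 := hσ a ha
      have h3 : a / (1 + L * a) ≤ a := div_le_self ha.le h2.le
      refine (Real.rpow_le_rpow_of_exponent_ge' (by positivity) (by linarith) zero_le_one hn).trans ?_
      rwa [Real.rpow_one]
    have hsa : 0 < s a := by linarith [hs a ha]
    have hPc := (locallyLipschitz_supConv (p := p) (by linarith) hsa hf).continuous
    have hPB := abs_supConv_le (p := p) (by linarith) hsa.le hf
    rw [le_div_iff₀ (by positivity)] at ha₁ ha₂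
    have h := log_integral_exp_mul_div_le (μ := μ) hPc hPB (hk a ha) (by nlinarith)
    have hP₁ := (locallyLipschitz_supConv (p := p) (by linarith) one_pos hf).continuous
    have hP₁B := abs_supConv_le (p := p) (by linarith) zero_le_one hf
    have hle : ∫ x, supConv p (s a) f x ∂μ ≤ ∫ x, supConv p 1 f x ∂μ :=
      integral_mono (integrable_of_continuous_of_abs_le hPc hPB)
        (integrable_of_continuous_of_abs_le hP₁ hP₁B)
        fun x => supConv_anti zero_le_one (hs a ha) hf x
    have hkB : k a * B ^ 2 ≤ ε := by nlinarith [sq_nonneg B]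
    have := hmono a ha hav
    simp only [hF] at this ⊢
    linarith
  have hs₁ : 0 < s v₁ := by linarith [hs v₁ hv₀]
  have hk₁ := hk v₁ hv₀
  have hPc := (locallyLipschitz_supConv (p := p) (by linarith) hs₁ hf).continuous
  have hPB := abs_supConv_le (p := p) (by linarith) hs₁.le hf
  have hkabs : ∀ {g : X → ℝ}, (∀ x, |g x| ≤ B) → ∀ x, |k v₁ * g x| ≤ k v₁ * B := fun hg x => by
    rw [abs_mul, abs_of_pos hk₁]; gcongr; exact hg x
  have if₁ := integrable_exp_of_continuous_of_abs_le (μ := μ) (hfc.const_mul (k v₁)) (hkabs hf)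
  have hle : ∫ x, Real.exp (k v₁ * f x) ∂μ ≤ ∫ x, Real.exp (k v₁ * supConv p (s v₁) f x) ∂μ :=
    integral_mono if₁
      (integrable_exp_of_continuous_of_abs_le (hPc.const_mul (k v₁)) (hkabs hPB)) fun x => by
        have := self_le_supConv (p := p) (by linarith) hs₁.le hf x
        simp only
        gcongr
  have hlog := Real.log_le_log (integral_exp_pos if₁) hle
  simp only [hF] at hlim
  rw [div_le_iff₀ hk₁] at hlim
  linarith

end FreeEnergy

/-- One half of the Donsker–Varadhan variational formula. -/
lemma integral_le_integral_llr_add_log {Ω : Type*} [MeasurableSpace Ω] {ν μ : Measure Ω}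
    [IsProbabilityMeasure ν] [IsProbabilityMeasure μ] (hac : ν ≪ μ)
    (hint : Integrable (llr ν μ) ν) {g : Ω → ℝ} (hg : Integrable g ν)
    (hexp : Integrable (fun x => Real.exp (g x)) μ) :
    ∫ x, g x ∂ν ≤ ∫ x, llr ν μ x ∂ν + Real.log (∫ x, Real.exp (g x) ∂μ) := by
  have := isProbabilityMeasure_tilted hexp
  have h := InformationTheory.integral_llr_add_sub_measure_univ_nonneg
    (hac.trans (absolutelyContinuous_tilted hexp))
    (integrable_llr_tilted_right hac hg hint hexp)
  rw [integral_llr_tilted_right hac hg hexp hint] at h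
  simp only [probReal_univ] at h
  linarith

lemma integral_llr_nonneg {Ω : Type*} [MeasurableSpace Ω] {ν μ : Measure Ω}
    [IsProbabilityMeasure ν] [IsProbabilityMeasure μ] (hac : ν ≪ μ)
    (hint : Integrable (llr ν μ) ν) : 0 ≤ ∫ x, llr ν μ x ∂ν := by
  have h := InformationTheory.integral_llr_add_sub_measure_univ_nonneg hac hint
  simpa only [probReal_univ, add_sub_cancel_right] using h

open BoundedContinuousFunction

section Kantorovich

variable {X : Type*} [MetricSpace X] [MeasurableSpace X] [BorelSpace X]
  {ν μ : Measure X} [IsProbabilityMeasure ν] [IsProbabilityMeasure μ] {c : X × X → ℝ} {K : ℝ}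

lemma integral_add_integral_add_mul_nonneg
    (hdual : ∀ φ ψ : X →ᵇ ℝ, (∀ x y, φ x + ψ y ≤ c (x, y)) → ∫ x, φ x ∂ν + ∫ y, ψ y ∂μ ≤ K)
    (φ ψ : X →ᵇ ℝ) {l : ℝ} (hl : 0 ≤ l) (h : ∀ x y, 0 ≤ φ x + ψ y + l * c (x, y)) :
    0 ≤ ∫ x, φ x ∂ν + ∫ y, ψ y ∂μ + l * K := by
  rcases hl.eq_or_lt with rfl | hl
  · have h₁ : ∀ y, -ψ y ≤ ∫ x, φ x ∂ν := by
      intro y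
      have := integral_mono (integrable_const (-ψ y)) (φ.integrable ν)
        (fun x => by have := h x y; simp only [zero_mul, add_zero] at this; dsimp only; linarith)
      simpa using this
    have h₂ := integral_mono (ψ.integrable μ).neg (integrable_const (∫ x, φ x ∂ν)) h₁
    simp only [Pi.neg_apply, integral_neg, integral_const, probReal_univ, one_smul] at h₂
    linarith
  · have h₁ := hdual (-l⁻¹ • φ) (-l⁻¹ • ψ) (fun x y => by
      have := mul_nonneg (inv_nonneg.2 hl.le) (h x y)
      simp only [BoundedContinuousFunction.coe_smul, smul_eq_mul]
      rw [mul_add, inv_mul_cancel_left₀ hl.ne'] at this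
      linarith)
    simp only [BoundedContinuousFunction.coe_smul, smul_eq_mul, integral_const_mul] at h₁
    have h₂ := mul_le_mul_of_nonneg_left h₁ hl.le
    have h₃ := mul_inv_cancel₀ hl.ne'
    linear_combination h₂ + (∫ x, φ x ∂ν + ∫ y, ψ y ∂μ) * h₃

/-- Hahn–Banach step of Kantorovich duality: a dual bound produces a linear functional on bounded
continuous functions that plays the role of integration against a transport plan. -/
lemma exists_linearMap_le_of_dual
    (hdual : ∀ φ ψ : X →ᵇ ℝ, (∀ x y, φ x + ψ y ≤ c (x, y)) → ∫ x, φ x ∂ν + ∫ y, ψ y ∂μ ≤ K) :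
    ∃ g : (X × X →ᵇ ℝ) →ₗ[ℝ] ℝ, ∀ (w : X × X →ᵇ ℝ) (φ ψ : X →ᵇ ℝ) (l : ℝ), 0 ≤ l →
      (∀ x y, w (x, y) ≤ φ x + ψ y + l * c (x, y)) →
      g w ≤ ∫ x, φ x ∂ν + ∫ y, ψ y ∂μ + l * K := by
  let S : (X × X →ᵇ ℝ) → Set ℝ := fun w => {r | ∃ (φ ψ : X →ᵇ ℝ) (l : ℝ), 0 ≤ l ∧
    (∀ x y, w (x, y) ≤ φ x + ψ y + l * c (x, y)) ∧ r = ∫ x, φ x ∂ν + ∫ y, ψ y ∂μ + l * K}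
  have hne : ∀ w, (S w).Nonempty := fun w => ⟨_, BoundedContinuousFunction.const X ‖w‖, 0, 0,
    le_rfl, fun x y => by simpa using (le_abs_self _).trans (w.norm_coe_le_norm (x, y)), rfl⟩
  have hbdd : ∀ w, BddBelow (S w) := by
    rintro w
    refine ⟨-‖w‖, ?_⟩
    rintro _ ⟨φ, ψ, l, hl, hw, rfl⟩
    have := integral_add_integral_add_mul_nonneg hdual
      (φ + BoundedContinuousFunction.const X ‖w‖) ψ hl (fun x y => by
        have h₁ := hw x y
        have h₂ := (neg_le_abs _).trans (w.norm_coe_le_norm (x, y))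
        simp only [BoundedContinuousFunction.coe_add, Pi.add_apply,
          BoundedContinuousFunction.const_apply]
        linarith)
    simp only [BoundedContinuousFunction.coe_add, Pi.add_apply,
      BoundedContinuousFunction.const_apply] at this
    rw [integral_add (φ.integrable ν) (integrable_const _)] at this
    simp only [integral_const, probReal_univ, one_smul] at this
    linarith
  have hadd : ∀ v w, sInf (S (v + w)) ≤ sInf (S v) + sInf (S w) := by
    intro v w
    rw [← csInf_add (hne v) (hbdd v) (hne w) (hbdd w)]
    refine csInf_le_csInf (hbdd _) ((hne v).add (hne w)) ?_
    rintro _ ⟨_, ⟨φ, ψ, l, hl, hv, rfl⟩, _, ⟨φ', ψ', l', hl', hw, rfl⟩, rfl⟩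
    refine ⟨φ + φ', ψ + ψ', l + l', add_nonneg hl hl', fun x y => ?_, ?_⟩
    · have h₁ := hv x y
      have h₂ := hw x y
      simp only [BoundedContinuousFunction.coe_add, Pi.add_apply]
      linarith
    · simp only [BoundedContinuousFunction.coe_add, Pi.add_apply]
      rw [integral_add (φ.integrable ν) (φ'.integrable ν),
        integral_add (ψ.integrable μ) (ψ'.integrable μ)]
      ring
  have hsmul_le : ∀ a : ℝ, 0 < a → ∀ w, sInf (S (a • w)) ≤ a * sInf (S w) := by
    intro a ha w
    rw [← inv_mul_le_iff₀ ha]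
    refine le_csInf (hne w) ?_
    rintro _ ⟨φ, ψ, l, hl, hw, rfl⟩
    rw [inv_mul_le_iff₀ ha]
    refine csInf_le (hbdd _) ⟨a • φ, a • ψ, a * l, mul_nonneg ha.le hl, fun x y => ?_, ?_⟩
    · have h₁ := mul_le_mul_of_nonneg_left (hw x y) ha.le
      simp only [BoundedContinuousFunction.coe_smul, smul_eq_mul]
      linarith
    · simp only [BoundedContinuousFunction.coe_smul, smul_eq_mul, integral_const_mul]
      ring
  have hsmul : ∀ a : ℝ, 0 < a → ∀ w, sInf (S (a • w)) = a * sInf (S w) := by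
    intro a ha w
    refine (hsmul_le a ha w).antisymm ?_
    have := hsmul_le a⁻¹ (inv_pos.2 ha) (a • w)
    rwa [smul_smul, inv_mul_cancel₀ ha.ne', one_smul, le_inv_mul_iff₀ ha] at this
  have hzero : sInf (S 0) = 0 := by
    have := hsmul 2 two_pos 0
    rw [smul_zero] at this
    linarith
  obtain ⟨g, -, hg⟩ := exists_extension_of_le_sublinear (⊥ : (X × X →ᵇ ℝ) →ₗ.[ℝ] ℝ)
    (fun w => sInf (S w)) hsmul hadd (by
      rintro ⟨w, hw⟩
      obtain rfl : w = 0 := (Submodule.mem_bot ℝ).1 hw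
      exact le_of_eq ((LinearPMap.map_zero _).trans hzero.symm))
  exact ⟨g, fun w φ ψ l hl hw => (hg w).trans (csInf_le (hbdd w) ⟨φ, ψ, l, hl, hw, rfl⟩)⟩

/-- A continuous cutoff equal to `1` on the ball of radius `n` and to `0` outside the ball of
radius `n + 1`. -/
noncomputable def ballCutoff {Z : Type*} [MetricSpace Z] (z₀ : Z) (n : ℕ) : Z →ᵇ ℝ :=
  BoundedContinuousFunction.ofNormedAddCommGroup (fun z => max 0 (min 1 (n + 1 - dist z z₀)))
    (by fun_prop) 1 (fun z => by
      rw [Real.norm_eq_abs, abs_of_nonneg (le_max_left _ _)]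
      exact max_le zero_le_one (min_le_left _ _))

section BallCutoff

variable {Z : Type*} [MetricSpace Z] (z₀ : Z)

lemma ballCutoff_apply (n : ℕ) (z : Z) :
    ballCutoff z₀ n z = max 0 (min 1 (n + 1 - dist z z₀)) := rfl

lemma ballCutoff_nonneg (n : ℕ) (z : Z) : 0 ≤ ballCutoff z₀ n z := le_max_left _ _

lemma ballCutoff_le_one (n : ℕ) (z : Z) : ballCutoff z₀ n z ≤ 1 :=
  max_le zero_le_one (min_le_left _ _)

lemma hasCompactSupport_ballCutoff [ProperSpace Z] (n : ℕ) :
    HasCompactSupport (ballCutoff z₀ n) := by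
  refine HasCompactSupport.intro (isCompact_closedBall z₀ (n + 1)) fun z hz => ?_
  rw [Metric.mem_closedBall, not_le] at hz
  rw [ballCutoff_apply]
  exact max_eq_left ((min_le_right _ _).trans (by linarith))

lemma tendsto_ballCutoff (z : Z) : Tendsto (fun n => ballCutoff z₀ n z) atTop (𝓝 1) := by
  refine tendsto_const_nhds.congr' ?_
  filter_upwards [eventually_ge_atTop ⌈dist z z₀⌉₊] with n hn
  have := (Nat.le_ceil (dist z z₀)).trans (Nat.cast_le.2 hn)
  rw [ballCutoff_apply, min_eq_left (by linarith), max_eq_right zero_le_one]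

lemma tendsto_integral_ballCutoff [MeasurableSpace Z] [BorelSpace Z] (ρ : Measure Z)
    [IsProbabilityMeasure ρ] : Tendsto (fun n => ∫ z, ballCutoff z₀ n z ∂ρ) atTop (𝓝 1) := by
  have h := tendsto_integral_of_dominated_convergence (μ := ρ)
    (F := fun n z => ballCutoff z₀ n z) (f := fun _ => (1 : ℝ)) (fun _ => 1)
    (fun n => ((ballCutoff z₀ n).integrable ρ).aestronglyMeasurable) (integrable_const _)
    (fun n => ae_of_all _ fun z => by
      rw [Real.norm_eq_abs, abs_of_nonneg (ballCutoff_nonneg z₀ n z)]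
      exact ballCutoff_le_one z₀ n z)
    (ae_of_all _ (tendsto_ballCutoff z₀))
  simpa using h

lemma ballCutoff_add_le_ballCutoff_prod {X : Type*} [MetricSpace X] (x₀ : X) (n : ℕ) (x y : X) :
    ballCutoff x₀ n x + ballCutoff x₀ n y ≤ 1 + ballCutoff (x₀, x₀) n (x, y) := by
  have hx := ballCutoff_le_one x₀ n x
  have hy := ballCutoff_le_one x₀ n y
  rcases le_total (dist x x₀) (dist y x₀) with h | h
  · have : ballCutoff (x₀, x₀) n (x, y) = ballCutoff x₀ n y := by
      simp only [ballCutoff_apply, Prod.dist_eq, max_eq_right h]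
    linarith
  · have : ballCutoff (x₀, x₀) n (x, y) = ballCutoff x₀ n x := by
      simp only [ballCutoff_apply, Prod.dist_eq, max_eq_left h]
    linarith

end BallCutoff

open CompactlySupported in
/-- A positive linear functional on bounded continuous functions on a proper space which is tight
is integration against a finite measure. -/
lemma exists_measure_forall_integral_eq {Z : Type*} [MetricSpace Z] [ProperSpace Z]
    [MeasurableSpace Z] [BorelSpace Z] (g : (Z →ᵇ ℝ) →ₗ[ℝ] ℝ)
    (hg : ∀ w : Z →ᵇ ℝ, (∀ z, 0 ≤ w z) → 0 ≤ g w) (z₀ : Z)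
    (htight : Tendsto (fun n => g (ballCutoff z₀ n)) atTop (𝓝 (g 1))) :
    ∃ π : Measure Z, IsFiniteMeasure π ∧ ∀ w : Z →ᵇ ℝ, ∫ z, w z ∂π = g w := by
  have hmono : ∀ v w : Z →ᵇ ℝ, (∀ z, v z ≤ w z) → g v ≤ g w := fun v w h => by
    have := hg (w - v) (fun z => sub_nonneg.2 (h z))
    rwa [map_sub, sub_nonneg] at this
  let Λ : C_c(Z, ℝ) →ₚ[ℝ] ℝ := PositiveLinearMap.mk₀
    { toFun := fun w => g w.toBoundedContinuousFunction
      map_add' := fun v w => by rw [← map_add]; rfl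
      map_smul' := fun a w => by rw [RingHom.id_apply, ← map_smul]; rfl }
    (fun w hw => hg _ hw)
  let π := RealRMK.rieszMeasure Λ
  have hcc : ∀ w : Z →ᵇ ℝ, HasCompactSupport w → ∫ z, w z ∂π = g w := fun w hw =>
    RealRMK.integral_rieszMeasure Λ ⟨w.toContinuousMap, hw⟩
  have hfin : IsFiniteMeasure π := by
    refine ⟨?_⟩
    have hlim : Tendsto (fun n => ENNReal.ofReal (g (ballCutoff z₀ n))) atTop
        (𝓝 (ENNReal.ofReal (g 1))) := ENNReal.tendsto_ofReal htight
    have hlint : ∀ n, ∫⁻ z, ENNReal.ofReal (ballCutoff z₀ n z) ∂π =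
        ENNReal.ofReal (g (ballCutoff z₀ n)) := fun n => by
      rw [← hcc _ (hasCompactSupport_ballCutoff z₀ n)]
      exact (ofReal_integral_eq_lintegral_ofReal
        ((ballCutoff z₀ n).continuous.integrable_of_hasCompactSupport
          (hasCompactSupport_ballCutoff z₀ n))
        (ae_of_all _ (ballCutoff_nonneg z₀ n))).symm
    have hfatou := lintegral_liminf_le (μ := π) (u := atTop)
      (f := fun n z => ENNReal.ofReal (ballCutoff z₀ n z))
      (fun n => (ballCutoff z₀ n).continuous.measurable.ennreal_ofReal)
    have hone : ∀ z, liminf (fun n => ENNReal.ofReal (ballCutoff z₀ n z)) atTop = 1 := fun z => by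
      simpa using (ENNReal.tendsto_ofReal (tendsto_ballCutoff z₀ z)).liminf_eq
    simp only [hone, hlint, lintegral_one, hlim.liminf_eq] at hfatou
    exact hfatou.trans_lt ENNReal.ofReal_lt_top
  refine ⟨π, hfin, fun w => ?_⟩
  have h₁ : Tendsto (fun n => ∫ z, (w * ballCutoff z₀ n) z ∂π) atTop (𝓝 (∫ z, w z ∂π)) := by
    refine tendsto_integral_of_dominated_convergence (fun _ => ‖w‖)
      (fun n => ((w * ballCutoff z₀ n).integrable π).aestronglyMeasurable) (integrable_const _)
      (fun n => ae_of_all _ fun z => ?_) (ae_of_all _ fun z => ?_)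
    · rw [BoundedContinuousFunction.mul_apply, norm_mul, Real.norm_eq_abs (ballCutoff z₀ n z),
        abs_of_nonneg (ballCutoff_nonneg z₀ n z)]
      exact (mul_le_of_le_one_right (norm_nonneg _) (ballCutoff_le_one z₀ n z)).trans
        (w.norm_coe_le_norm z)
    · simpa using (tendsto_ballCutoff z₀ z).const_mul (w z)
  have h₂ : Tendsto (fun n => g (w * ballCutoff z₀ n)) atTop (𝓝 (g w)) := by
    rw [tendsto_iff_norm_sub_tendsto_zero]
    have hlim : Tendsto (fun n => ‖w‖ * (g 1 - g (ballCutoff z₀ n))) atTop (𝓝 0) := by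
      simpa using (htight.const_sub (g 1)).const_mul ‖w‖
    refine squeeze_zero (fun _ => norm_nonneg _) (fun n => ?_) hlim
    have key : ∀ z, |w z * (1 - ballCutoff z₀ n z)| ≤ ‖w‖ * (1 - ballCutoff z₀ n z) := fun z => by
      have := sub_nonneg.2 (ballCutoff_le_one z₀ n z)
      rw [abs_mul, abs_of_nonneg this]
      exact mul_le_mul_of_nonneg_right (w.norm_coe_le_norm z) this
    have hu := hmono (w - w * ballCutoff z₀ n) (‖w‖ • (1 - ballCutoff z₀ n)) (fun z => by
      have := (le_abs_self _).trans (key z)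
      simp only [BoundedContinuousFunction.coe_sub, Pi.sub_apply,
        BoundedContinuousFunction.mul_apply, BoundedContinuousFunction.coe_smul, smul_eq_mul,
        BoundedContinuousFunction.coe_one, Pi.one_apply]
      linarith)
    have hl := hmono (w * ballCutoff z₀ n - w) (‖w‖ • (1 - ballCutoff z₀ n)) (fun z => by
      have := (neg_le_abs _).trans (key z)
      simp only [BoundedContinuousFunction.coe_sub, Pi.sub_apply,
        BoundedContinuousFunction.mul_apply, BoundedContinuousFunction.coe_smul, smul_eq_mul,
        BoundedContinuousFunction.coe_one, Pi.one_apply]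
      linarith)
    simp only [map_sub, map_smul, smul_eq_mul] at hu hl
    rw [Real.norm_eq_abs, abs_le]
    constructor <;> linarith
  have hsupp : ∀ n, HasCompactSupport (w * ballCutoff z₀ n : Z →ᵇ ℝ) := fun n =>
    (hasCompactSupport_ballCutoff z₀ n).mul_left
  simp only [fun n => hcc _ (hsupp n)] at h₁
  exact tendsto_nhds_unique h₁ h₂

/-- Kantorovich duality: a bound on the dual problem gives a transport plan. -/
theorem exists_coupling_lintegral_le_of_dual [ProperSpace X] (hc : Continuous c)
    (hc₀ : ∀ z, 0 ≤ c z)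
    (hdual : ∀ φ ψ : X →ᵇ ℝ, (∀ x y, φ x + ψ y ≤ c (x, y)) → ∫ x, φ x ∂ν + ∫ y, ψ y ∂μ ≤ K) :
    ∃ π : Measure (X × X), π.map Prod.fst = ν ∧ π.map Prod.snd = μ ∧
      ∫⁻ z, ENNReal.ofReal (c z) ∂π ≤ ENNReal.ofReal K := by
  obtain ⟨g, hg⟩ := exists_linearMap_le_of_dual hdual
  have hpos : ∀ w : X × X →ᵇ ℝ, (∀ z, 0 ≤ w z) → 0 ≤ g w := fun w hw => by
    have := hg (-w) 0 0 0 le_rfl (fun x y => by simpa using hw (x, y))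
    simpa using this
  have hsum : ∀ (w : X × X →ᵇ ℝ) (φ ψ : X →ᵇ ℝ), (∀ x y, w (x, y) = φ x + ψ y) →
      g w = ∫ x, φ x ∂ν + ∫ y, ψ y ∂μ := fun w φ ψ hw => by
    refine le_antisymm ?_ ?_
    · simpa using hg w φ ψ 0 le_rfl (fun x y => by simp [hw])
    · have := hg (-w) (-φ) (-ψ) 0 le_rfl (fun x y => by simp [hw, add_comm])
      simp only [map_neg, BoundedContinuousFunction.coe_neg, Pi.neg_apply, integral_neg,
        zero_mul] at this
      linarith
  have hone : g 1 = 1 := by simpa using hsum 1 1 0 (fun x y => by simp)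
  obtain ⟨x₀⟩ := nonempty_of_isProbabilityMeasure ν
  have htight : Tendsto (fun n => g (ballCutoff (x₀, x₀) n)) atTop (𝓝 (g 1)) := by
    rw [hone]
    have hlow : Tendsto (fun n => ∫ x, ballCutoff x₀ n x ∂ν + ∫ x, ballCutoff x₀ n x ∂μ - 1) atTop
        (𝓝 1) := by
      have := ((tendsto_integral_ballCutoff x₀ ν).add
        (tendsto_integral_ballCutoff x₀ μ)).sub_const 1
      simpa using this
    refine tendsto_of_tendsto_of_tendsto_of_le_of_le hlow tendsto_const_nhds (fun n => ?_)
      (fun n => ?_)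
    · have := hg (-(1 + ballCutoff (x₀, x₀) n)) (-ballCutoff x₀ n) (-ballCutoff x₀ n) 0 le_rfl
        (fun x y => by
          have := ballCutoff_add_le_ballCutoff_prod x₀ n x y
          simp only [BoundedContinuousFunction.coe_neg, BoundedContinuousFunction.coe_add,
            Pi.neg_apply, Pi.add_apply, BoundedContinuousFunction.coe_one, Pi.one_apply]
          linarith)
      simp only [map_neg, map_add, hone, BoundedContinuousFunction.coe_neg, Pi.neg_apply,
        integral_neg, zero_mul] at this
      dsimp only
      linarith
    · have := hpos (1 - ballCutoff (x₀, x₀) n) (fun z => sub_nonneg.2 (ballCutoff_le_one _ n z))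
      rwa [map_sub, hone, sub_nonneg] at this
  obtain ⟨π, hfin, hπ⟩ := exists_measure_forall_integral_eq g hpos (x₀, x₀) htight
  refine ⟨π, ?_, ?_, ?_⟩
  · refine ext_of_forall_integral_eq_of_IsFiniteMeasure fun φ => ?_
    rw [integral_map measurable_fst.aemeasurable φ.continuous.measurable.aestronglyMeasurable]
    have := (hπ (φ.compContinuous ⟨Prod.fst, continuous_fst⟩)).trans
      (hsum _ φ 0 (fun x y => by simp))
    simpa using this
  · refine ext_of_forall_integral_eq_of_IsFiniteMeasure fun ψ => ?_
    rw [integral_map measurable_snd.aemeasurable ψ.continuous.measurable.aestronglyMeasurable]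
    have := (hπ (ψ.compContinuous ⟨Prod.snd, continuous_snd⟩)).trans
      (hsum _ 0 ψ (fun x y => by simp))
    simpa using this
  · let w : ℕ → X × X →ᵇ ℝ := fun n => BoundedContinuousFunction.ofNormedAddCommGroup
      (fun z => min (c z) n) (by fun_prop) n (fun z => by
        rw [Real.norm_eq_abs, abs_of_nonneg (le_min (hc₀ z) n.cast_nonneg)]
        exact min_le_right _ _)
    have hw : ∀ n z, w n z = min (c z) n := fun n z => rfl
    have hbound : ∀ n, ∫⁻ z, ENNReal.ofReal (w n z) ∂π ≤ ENNReal.ofReal K := fun n => by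
      rw [← ofReal_integral_eq_lintegral_ofReal ((w n).integrable π)
        (ae_of_all _ fun z => le_min (hc₀ z) n.cast_nonneg), hπ]
      refine ENNReal.ofReal_le_ofReal ?_
      simpa using hg (w n) 0 0 1 zero_le_one (fun x y => by simp [hw])
    have hlim : Tendsto (fun n => ∫⁻ z, ENNReal.ofReal (w n z) ∂π) atTop
        (𝓝 (∫⁻ z, ENNReal.ofReal (c z) ∂π)) := by
      refine lintegral_tendsto_of_tendsto_of_monotone
        (fun n => (w n).continuous.measurable.ennreal_ofReal.aemeasurable)
        (ae_of_all _ fun z m n hmn => ENNReal.ofReal_le_ofReal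
          (min_le_min_left _ (Nat.cast_le.2 hmn))) (ae_of_all _ fun z => ?_)
      refine tendsto_const_nhds.congr' ?_
      filter_upwards [eventually_ge_atTop ⌈c z⌉₊] with n hn
      rw [hw, min_eq_left ((Nat.le_ceil _).trans (Nat.cast_le.2 hn))]
    exact le_of_tendsto' hlim hbound

end Kantorovich

lemma one_add_inv_rpow_le {n : ℝ} (hn : 1 ≤ n) :
    (1 + n⁻¹) ^ n ≤ n * (n + 1) ^ (1 / n) := by
  have hn₀ : 0 < n := by linarith
  have hn₁ : 0 < n + 1 := by linarith
  have hbase : 1 + n⁻¹ = (n + 1) / n := by field_simp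
  have hlog₁ : Real.log (n + 1) - Real.log n ≤ n⁻¹ := by
    rw [← Real.log_div hn₁.ne' hn₀.ne', ← hbase]
    have := Real.log_le_sub_one_of_pos (show 0 < 1 + n⁻¹ by positivity)
    linarith
  have hlog₂ := Real.one_sub_inv_le_log_of_pos hn₀
  have hinv : n * n⁻¹ = 1 := mul_inv_cancel₀ hn₀.ne'
  have hkey : (n - 1) * Real.log (n + 1) ≤ n * Real.log n := by
    have := mul_le_mul_of_nonneg_left hlog₁ (show 0 ≤ n - 1 by linarith)
    linarith
  rw [← Real.log_le_log_iff (by positivity) (by positivity), Real.log_rpow (by positivity),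
    Real.log_mul hn₀.ne' (by positivity), Real.log_rpow hn₁, hbase,
    Real.log_div hn₁.ne' hn₀.ne']
  refine le_of_mul_le_mul_left ?_ hn₀
  have h₂ := mul_le_mul_of_nonneg_left hkey hn₁.le
  have h₃ : n * (Real.log n + 1 / n * Real.log (n + 1)) = n * Real.log n + Real.log (n + 1) := by
    field_simp
  rw [h₃]
  linarith

lemma sq_mul_rpow_le_integral {n t : ℝ} (hn : 1 ≤ n) (ht₀ : 0 < t) (ht₁ : t < 1) :
    n ^ 2 * t ^ (1 / n) ≤ ∫ u in (0 : ℝ)..t, ((1 - u ^ (1 / n)) ^ (-n) - 1) / u := by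
  have hn₀ : 0 < n := by linarith
  have hr : 0 < 1 / n := by positivity
  have hx₁ : t ^ (1 / n) < 1 := Real.rpow_lt_one ht₀.le ht₁ hr
  have hx₀ : 0 < t ^ (1 / n) := Real.rpow_pos_of_pos ht₀ _
  have hpow : ∀ a : ℝ, IntervalIntegrable (fun u : ℝ => a * u ^ (1 / n - 1)) volume 0 t := fun a =>
    (intervalIntegral.intervalIntegrable_rpow' (by linarith)).const_mul a
  have hle : ∀ u, 0 < u → u ≤ t →
      n * u ^ (1 / n - 1) ≤ ((1 - u ^ (1 / n)) ^ (-n) - 1) / u ∧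
      ((1 - u ^ (1 / n)) ^ (-n) - 1) / u ≤
        ((1 - t ^ (1 / n)) ^ (-n) - 1) / t ^ (1 / n) * u ^ (1 / n - 1) := by
    intro u hu hut
    have hv₀ : 0 < u ^ (1 / n) := Real.rpow_pos_of_pos hu _
    have hvx : u ^ (1 / n) ≤ t ^ (1 / n) := Real.rpow_le_rpow hu.le hut hr.le
    rw [Real.rpow_sub_one hu.ne']
    constructor
    · rw [← mul_div_assoc]
      exact div_le_div_of_nonneg_right
        (mul_le_one_sub_rpow_neg_sub_one hn hv₀.le (hvx.trans_lt hx₁)) hu.le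
    · rw [← mul_div_assoc]
      refine div_le_div_of_nonneg_right
        ((one_sub_rpow_neg_sub_one_le hn hv₀.le hvx hx₀ hx₁).trans_eq ?_) hu.le
      ring
  have hint : IntervalIntegrable (fun u : ℝ => ((1 - u ^ (1 / n)) ^ (-n) - 1) / u) volume 0 t := by
    refine (hpow (((1 - t ^ (1 / n)) ^ (-n) - 1) / t ^ (1 / n))).mono_fun
      (Measurable.aestronglyMeasurable (by fun_prop)) ?_
    rw [Set.uIoc_of_le ht₀.le]
    refine (ae_restrict_iff' measurableSet_Ioc).2 (ae_of_all _ fun u hu => ?_)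
    obtain ⟨h₁, h₂⟩ := hle u hu.1 hu.2
    have h₀ : 0 ≤ n * u ^ (1 / n - 1) := mul_nonneg hn₀.le (Real.rpow_nonneg hu.1.le _)
    dsimp only
    rw [Real.norm_of_nonneg (h₀.trans h₁), Real.norm_of_nonneg (h₀.trans (h₁.trans h₂))]
    exact h₂
  calc n ^ 2 * t ^ (1 / n) = ∫ u in (0 : ℝ)..t, n * u ^ (1 / n - 1) := by
        rw [intervalIntegral.integral_const_mul, integral_rpow (Or.inl (by linarith)),
          sub_add_cancel, Real.zero_rpow hr.ne']
        field_simp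
        ring
    _ ≤ _ := intervalIntegral.integral_mono_on_of_le_Ioo ht₀.le (hpow n) hint
        (fun u hu => (hle u hu.1 hu.2.le).1)

/-- Lower bound for the constant `a_p` of the transport-entropy inequality. -/
lemma one_add_mul_rpow_le_sInf {p : ℝ} (hp : 2 ≤ p) :
    1 + p * (1 - 1 / p) ^ (-(p - 1)) ≤
      sInf {a : ℝ | ∃ t ∈ Set.Ioo (0:ℝ) 1, a = t ^ (-(p / (p - 1) - 1)) *
          (1 + p ^ (p / (p - 1)) / (p - 1) *
            ∫ u in (0:ℝ)..t, ((1 - u ^ (1 / (p - 1))) ^ (-(p - 1)) - 1) / u)} := by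
  refine le_csInf ⟨_, 1 / 2, by norm_num, rfl⟩ ?_
  rintro _ ⟨t, ⟨ht₀, ht₁⟩, rfl⟩
  obtain ⟨n, rfl⟩ : ∃ n, p = n + 1 := ⟨p - 1, by ring⟩
  simp only [add_sub_cancel_right]
  have hn : 1 ≤ n := by linarith
  have hn₀ : 0 < n := by linarith
  have hn₁ : 0 < n + 1 := by linarith
  have hq : (n + 1) / n = 1 + 1 / n := by field_simp
  have hbase : 1 - 1 / (n + 1) = (1 + n⁻¹)⁻¹ := by field_simp; ring
  have hx₀ : 0 < t ^ (1 / n) := Real.rpow_pos_of_pos ht₀ _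
  have hx₁ : t ^ (1 / n) ≤ 1 := Real.rpow_le_one ht₀.le ht₁.le (by positivity)
  rw [hq, add_sub_cancel_left, Real.rpow_neg ht₀.le, hbase, Real.inv_rpow (by positivity),
    Real.rpow_neg (by positivity), inv_inv, Real.rpow_add hn₁, Real.rpow_one]
  rw [le_inv_mul_iff₀ hx₀]
  have h₁ := one_add_inv_rpow_le hn
  have h₂ := sq_mul_rpow_le_integral hn ht₀ ht₁
  have h₃ := mul_le_mul_of_nonneg_left h₂
    (show 0 ≤ (n + 1) * (n + 1) ^ (1 / n) / n by positivity)
  have h₄ : (n + 1) * (n + 1) ^ (1 / n) / n * (n ^ 2 * t ^ (1 / n)) =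
      t ^ (1 / n) * ((n + 1) * (n * (n + 1) ^ (1 / n))) := by
    field_simp
  have h₅ := mul_le_mul_of_nonneg_left (mul_le_mul_of_nonneg_left h₁ hn₁.le) hx₀.le
  linarith

lemma log_integral_exp_le_of_tauLSI_max {X : Type*} [MetricSpace X] [ProperSpace X]
    [MeasurableSpace X] [BorelSpace X] {μ : Measure X} [IsProbabilityMeasure μ] {p A B : ℝ}
    {f : X → ℝ} (hp : 2 ≤ p) (hLSI : TauLSI μ (fun x => |x| ^ p) 1 A) (hfc : Continuous f)
    (hf : ∀ x, |f x| ≤ B) {a : ℝ} (ha : a = (1 + p * (1 - 1 / p) ^ (-(p - 1))) * max 1 A) :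
    Real.log (∫ x, Real.exp (a⁻¹ ^ (p - 1) * f x) ∂μ) ≤
      a⁻¹ ^ (p - 1) * ∫ x, supConv p 1 f x ∂μ := by
  have hp₀ : 0 < p := by linarith
  set M := max 1 A with hM
  have hM₁ : 1 ≤ M := le_max_left _ _
  have hM₀ : 0 < M := by linarith
  set E := (1 - 1 / p) ^ (-(p - 1)) - 1 with hE
  have hx₁ : 1 / p < 1 := by rw [div_lt_one hp₀]; linarith
  have hE₀ : 0 ≤ E := le_trans (mul_nonneg (by linarith) (by positivity))
    (mul_le_one_sub_rpow_neg_sub_one (v := 1 / p) (n := p - 1) (by linarith) (by positivity) hx₁)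
  have hvx : 1 / (p * M) ≤ 1 / p :=
    one_div_le_one_div_of_le hp₀ (le_mul_of_one_le_right hp₀.le hM₁)
  have h := log_integral_exp_le_of_tauLSI (M := M) (L := M * (p * E + 1)) (L₀ := M * E * p)
    (v₁ := 1 / (p * M)) hp hLSI (le_max_right _ _) hM₀.le hfc hf (by positivity)
    (hvx.trans_lt hx₁) (by positivity) (by linarith) (fun v hv₀ hv => by
      have := mul_le_mul_of_nonneg_left (one_sub_rpow_neg_sub_one_le (n := p - 1) (by linarith)
        hv₀.le (hv.trans hvx) (by positivity) hx₁) hM₀.le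
      rw [← hE, div_div_eq_mul_div, div_one] at this
      linarith)
  have hinv : 1 / (p * M) / (1 + M * (p * E + 1) * (1 / (p * M))) = a⁻¹ := by
    have h₁ : (1 - 1 / p) ^ (-(p - 1)) = E + 1 := by rw [hE]; ring
    rw [ha, h₁]
    have h₂ : 0 < p * E + 1 := by positivity
    field_simp
    ring
  rwa [hinv] at h

theorem tau_lsi_p_implies_transport_entropy_p
    {X : Type*} [MetricSpace X] [CompleteSpace X] [TopologicalSpace.SeparableSpace X]
    [ProperSpace X] [MeasurableSpace X] [BorelSpace X]
    (p : ℝ) (hp : 2 ≤ p)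
    (μ : Measure X) [IsProbabilityMeasure μ] (A : ℝ) (hA : 0 < A)
    (hLSI : TauLSI μ (fun x => |x| ^ p) 1 A) :
    TransportEntropy μ (fun x => |x| ^ p)
      ((sInf {a : ℝ | ∃ t ∈ Set.Ioo (0:ℝ) 1, a = t ^ (-(p / (p - 1) - 1)) *
          (1 + p ^ (p / (p - 1)) / (p - 1) *
            ∫ u in (0:ℝ)..t, ((1 - u ^ (1 / (p - 1))) ^ (-(p - 1)) - 1) / u)} *
        max 1 A) ^ (p - 1)) := by
  have hp₀ : 0 < p := by linarith
  have hbound := one_add_mul_rpow_le_sInf hp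
  set S := sInf {a : ℝ | ∃ t ∈ Set.Ioo (0:ℝ) 1, a = t ^ (-(p / (p - 1) - 1)) *
    (1 + p ^ (p / (p - 1)) / (p - 1) *
      ∫ u in (0:ℝ)..t, ((1 - u ^ (1 / (p - 1))) ^ (-(p - 1)) - 1) / u)}
  obtain ⟨a, ha⟩ : ∃ a, a = (1 + p * (1 - 1 / p) ^ (-(p - 1))) * max 1 A := ⟨_, rfl⟩
  have hbase : 0 < 1 - 1 / p := by rw [sub_pos, div_lt_one hp₀]; linarith
  have hM : 0 < max 1 A := lt_max_of_lt_left one_pos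
  have ha₀ : 0 < a := by rw [ha]; positivity
  have haS : a ≤ S * max 1 A := by rw [ha]; exact mul_le_mul_of_nonneg_right hbound hM.le
  have haC : a ^ (p - 1) ≤ (S * max 1 A) ^ (p - 1) :=
    Real.rpow_le_rpow ha₀.le haS (by linarith)
  have hC : 0 < a ^ (p - 1) := Real.rpow_pos_of_pos ha₀ _
  intro ν hν
  rw [relEnt]
  split_ifs with hent
  swap
  · rw [ENNReal.mul_top (ENNReal.ofReal_pos.2 (hC.trans_le haC)).ne']
    exact le_top
  obtain ⟨hac, hint⟩ := hent
  change transportCost _ ν μ ≤ _ * ENNReal.ofReal (∫ x, llr ν μ x ∂ν)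
  change Integrable (llr ν μ) ν at hint
  have hH := integral_llr_nonneg hac hint
  obtain ⟨π, hπ₁, hπ₂, hπ⟩ := exists_coupling_lintegral_le_of_dual (ν := ν) (μ := μ)
    (c := fun z : X × X => |dist z.1 z.2| ^ p) (K := a ^ (p - 1) * ∫ x, llr ν μ x ∂ν)
    ((Real.continuous_rpow_const hp₀.le).comp continuous_dist.abs) (fun z => by positivity)
    (fun φ ψ hφψ => by
      have hφ : ∀ x, |φ x| ≤ ‖φ‖ := φ.norm_coe_le_norm
      have hsup : ∀ y, supConv p 1 φ y ≤ -ψ y := fun y => by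
        have : Nonempty X := ⟨y⟩
        refine supConv_le fun x => ?_
        have h := hφψ x y
        rw [abs_of_nonneg dist_nonneg, dist_comm] at h
        linarith
      have hsupint : ∫ y, supConv p 1 φ y ∂μ ≤ -∫ y, ψ y ∂μ := by
        rw [← integral_neg]
        exact integral_mono (integrable_of_continuous_of_abs_le
          (locallyLipschitz_supConv (by linarith) one_pos hφ).continuous
          (abs_supConv_le hp₀ zero_le_one hφ)) (ψ.integrable μ).neg hsup
      have hk : 0 < a⁻¹ ^ (p - 1) := Real.rpow_pos_of_pos (inv_pos.2 ha₀) _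
      have hgibbs := integral_le_integral_llr_add_log hac hint
        ((φ.integrable ν).const_mul (a⁻¹ ^ (p - 1)))
        (integrable_exp_of_continuous_of_abs_le (B := a⁻¹ ^ (p - 1) * ‖φ‖)
          (φ.continuous.const_mul _) (fun x => by
            rw [abs_mul, abs_of_pos hk]
            exact mul_le_mul_of_nonneg_left (hφ x) hk.le))
      rw [integral_const_mul] at hgibbs
      have hlog := log_integral_exp_le_of_tauLSI_max hp hLSI φ.continuous hφ ha
      have hsupint' := mul_le_mul_of_nonneg_left hsupint hk.le
      have hfinal : a⁻¹ ^ (p - 1) * (∫ x, φ x ∂ν + ∫ y, ψ y ∂μ) ≤ ∫ x, llr ν μ x ∂ν := by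
        linarith
      rwa [Real.inv_rpow ha₀.le, inv_mul_le_iff₀ hC] at hfinal)
  calc transportCost (fun x => |x| ^ p) ν μ
      ≤ ∫⁻ z, ENNReal.ofReal (|dist z.1 z.2| ^ p) ∂π := sInf_le ⟨π, hπ₁, hπ₂, rfl⟩
    _ ≤ ENNReal.ofReal (a ^ (p - 1) * ∫ x, llr ν μ x ∂ν) := hπ
    _ ≤ ENNReal.ofReal ((S * max 1 A) ^ (p - 1)) * ENNReal.ofReal (∫ x, llr ν μ x ∂ν) := by
      rw [← ENNReal.ofReal_mul (hC.le.trans haC)]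
      exact ENNReal.ofReal_le_ofReal (mul_le_mul_of_nonneg_right haC hH)
end

section
/- Let α be a Young function satisfying the Δ₂-condition and let p_α = sup_{x>0} x·α'₊(x)/α(x). Then the function x ↦ α(x)^{1/p_α} is subadditive on [0,∞), i.e., α(x+y)^{1/p_α} ≤ α(x)^{1/p_α} + α(y)^{1/p_α} for all x,y ≥ 0. Consequently, for any metric space (X,d), the function d_α(x,y) = α(d(x,y))^{1/p_α} is a distance on X. -/
open MeasureTheory Filter Set Topology
open scoped ENNReal NNReal

namespace IsYoung

variable {α : ℝ → ℝ}

lemma pos (hα : IsYoung α) {x : ℝ} (hx : 0 < x) : 0 < α x := by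
  simpa [hα.zero] using hα.mono (mem_Ici.2 le_rfl) (mem_Ici.2 hx.le) hx

lemma le_mul_rightD (hα : IsYoung α) {x : ℝ} (hx : 0 < x) : α x ≤ x * rightD α x := by
  have hslope := hα.convex.slope_le_leftDeriv_of_mem_interior (mem_univ 0) (y := x) (by simp) hx
  have hle := hslope.trans
    (hα.convex.leftDeriv_le_rightDeriv_of_mem_interior (x := x) (by simp))
  rw [slope_def_field, hα.zero, sub_zero, sub_zero, div_le_iff₀ hx, mul_comm] at hle
  exact hle

lemma mul_rightD_le (hα : IsYoung α) {x : ℝ} (hx : 0 < x) :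
    x * rightD α x ≤ α (2 * x) - α x := by
  have hle := hα.convex.rightDeriv_le_slope_of_mem_interior (x := x) (y := 2 * x) (by simp)
    (mem_univ _) (by linarith)
  rw [slope_def_field, show 2 * x - x = x by ring, le_div_iff₀ hx, mul_comm] at hle
  exact hle

lemma bddAbove_index (hα : IsYoung α) (hΔ : DeltaTwo α) :
    BddAbove {r : ℝ | ∃ x > 0, r = x * rightD α x / α x} := by
  obtain ⟨K, -, hK⟩ := hΔ
  refine ⟨K - 1, ?_⟩
  rintro r ⟨x, hx, rfl⟩
  rw [div_le_iff₀ (hα.pos hx)]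
  linarith [hα.mul_rightD_le hx, hK x]

lemma mul_rightD_le_pAlpha_mul (hα : IsYoung α) (hΔ : DeltaTwo α) {x : ℝ} (hx : 0 < x) :
    x * rightD α x ≤ pAlpha α * α x :=
  (div_le_iff₀ (hα.pos hx)).1 (le_csSup (hα.bddAbove_index hΔ) ⟨x, hx, rfl⟩)

lemma one_le_pAlpha (hα : IsYoung α) (hΔ : DeltaTwo α) : 1 ≤ pAlpha α := by
  have hle := (hα.le_mul_rightD one_pos).trans (hα.mul_rightD_le_pAlpha_mul hΔ one_pos)
  exact le_of_mul_le_mul_right (by simpa using hle) (hα.pos one_pos)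

/-- The function `x ↦ α(x) / x ^ p_α` is nonincreasing on `(0,∞)`. -/
lemma antitoneOn_mul_rpow_neg (hα : IsYoung α) (hΔ : DeltaTwo α) :
    AntitoneOn (fun x ↦ α x * x ^ (-pAlpha α)) (Ioi 0) := by
  intro a ha b _ hab
  rw [mem_Ioi] at ha
  have hcont : Continuous α :=
    continuousOn_univ.1 (hα.convex.continuousOn isOpen_univ)
  refine image_le_of_deriv_right_le_deriv_boundary (a := a) (b := b)
    (f := fun x ↦ α x * x ^ (-pAlpha α))
    (f' := fun x ↦ rightD α x * x ^ (-pAlpha α) + α x * (-pAlpha α * x ^ (-pAlpha α - 1)))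
    (B := fun _ ↦ α a * a ^ (-pAlpha α)) (B' := fun _ ↦ 0)
    ?_ ?_ le_rfl continuousOn_const (fun x _ ↦ hasDerivWithinAt_const x _ _) ?_
    (right_mem_Icc.2 hab)
  · exact hcont.continuousOn.mul
      (continuousOn_id.rpow_const fun x hx ↦ Or.inl (ha.trans_le hx.1).ne')
  · intro x hx
    have hx0 : 0 < x := ha.trans_le hx.1
    have hderiv : HasDerivWithinAt α (rightD α x) (Ici x) x :=
      (hα.convex.hasDerivWithinAt_rightDeriv_of_mem_interior (by simp)).Ici_of_Ioi
    exact hderiv.mul (Real.hasDerivAt_rpow_const (Or.inl hx0.ne')).hasDerivWithinAt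
  · intro x hx
    have hx0 : 0 < x := ha.trans_le hx.1
    have hsplit : x ^ (-pAlpha α) = x * x ^ (-pAlpha α - 1) := by
      rw [Real.rpow_sub_one hx0.ne']
      field_simp
    have hpow : 0 < x ^ (-pAlpha α - 1) := Real.rpow_pos_of_pos hx0 _
    have hle := hα.mul_rightD_le_pAlpha_mul hΔ hx0
    rw [hsplit]
    nlinarith

/-- The function `x ↦ α(x) ^ (1 / p_α) / x` is nonincreasing on `(0,∞)`. -/
lemma antitoneOn_rpow_div (hα : IsYoung α) (hΔ : DeltaTwo α) :
    AntitoneOn (fun x ↦ α x ^ (1 / pAlpha α) / x) (Ioi 0) := by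
  have hp : 0 < pAlpha α := one_pos.trans_le (hα.one_le_pAlpha hΔ)
  have heq : ∀ x : ℝ, 0 < x →
      (α x * x ^ (-pAlpha α)) ^ (1 / pAlpha α) = α x ^ (1 / pAlpha α) / x := by
    intro x hx
    rw [Real.mul_rpow (hα.nonneg x) (Real.rpow_nonneg hx.le _), ← Real.rpow_mul hx.le,
      show -pAlpha α * (1 / pAlpha α) = -1 by field_simp, Real.rpow_neg_one, ← div_eq_mul_inv]
  intro a ha b hb hab
  simp only [← heq a ha, ← heq b hb]
  exact Real.rpow_le_rpow (mul_nonneg (hα.nonneg b) (Real.rpow_nonneg (le_of_lt hb) _))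
    (hα.antitoneOn_mul_rpow_neg hΔ ha hb hab) (by positivity)

lemma rpow_add_le (hα : IsYoung α) (hΔ : DeltaTwo α) {x y : ℝ} (hx : 0 ≤ x) (hy : 0 ≤ y) :
    α (x + y) ^ (1 / pAlpha α) ≤ α x ^ (1 / pAlpha α) + α y ^ (1 / pAlpha α) := by
  rcases hx.eq_or_lt with rfl | hx
  · simpa using Real.rpow_nonneg (hα.nonneg 0) _
  rcases hy.eq_or_lt with rfl | hy
  · simpa using Real.rpow_nonneg (hα.nonneg 0) _
  have hxy : 0 < x + y := add_pos hx hy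
  have hleft : α (x + y) ^ (1 / pAlpha α) / (x + y) ≤ α x ^ (1 / pAlpha α) / x :=
    hα.antitoneOn_rpow_div hΔ hx hxy (by linarith)
  have hright : α (x + y) ^ (1 / pAlpha α) / (x + y) ≤ α y ^ (1 / pAlpha α) / y :=
    hα.antitoneOn_rpow_div hΔ hy hxy (by linarith)
  rw [le_div_iff₀ hx] at hleft
  rw [le_div_iff₀ hy] at hright
  calc α (x + y) ^ (1 / pAlpha α)
      = α (x + y) ^ (1 / pAlpha α) / (x + y) * x
        + α (x + y) ^ (1 / pAlpha α) / (x + y) * y := by field_simp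
    _ ≤ _ := add_le_add hleft hright

end IsYoung

theorem young_root_subadditive (α : ℝ → ℝ) (hα : IsYoung α) (hΔ : DeltaTwo α) :
    (∀ x y : ℝ, 0 ≤ x → 0 ≤ y →
      α (x + y) ^ (1 / pAlpha α) ≤ α x ^ (1 / pAlpha α) + α y ^ (1 / pAlpha α)) ∧
    ∀ (X : Type*) [MetricSpace X], ∀ x y z : X,
      (α (dist x y) ^ (1 / pAlpha α) = 0 ↔ x = y) ∧
      α (dist x y) ^ (1 / pAlpha α) = α (dist y x) ^ (1 / pAlpha α) ∧
      α (dist x z) ^ (1 / pAlpha α) ≤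
        α (dist x y) ^ (1 / pAlpha α) + α (dist y z) ^ (1 / pAlpha α) := by
  have hp : 0 < pAlpha α := one_pos.trans_le (hα.one_le_pAlpha hΔ)
  refine ⟨fun x y hx hy ↦ hα.rpow_add_le hΔ hx hy, fun X _ x y z ↦ ⟨⟨fun h ↦ ?_, ?_⟩, ?_, ?_⟩⟩
  · by_contra hne
    exact (Real.rpow_pos_of_pos (hα.pos (dist_pos.2 hne)) _).ne' h
  · rintro rfl
    rw [dist_self, hα.zero, Real.zero_rpow (one_div_pos.2 hp).ne']
  · rw [dist_comm]
  · refine le_trans (Real.rpow_le_rpow (hα.nonneg _) ?_ (one_div_pos.2 hp).le)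
      (hα.rpow_add_le hΔ dist_nonneg dist_nonneg)
    exact hα.mono.monotoneOn (mem_Ici.2 dist_nonneg)
      (mem_Ici.2 (add_nonneg dist_nonneg dist_nonneg)) (dist_triangle x y z)
end
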